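/- arXiv:2309.14270 — 2 statements merged into one kernel-verified Lean document; each statement's English description precedes it below -/
import Mathlib

section
/- Let A^μ_ν (μ,ν ∈ {1,…,n}) be a family of N×N complex matrices and J an invertible n×n real matrix with inverse J^{-1}. Define the transformed tensor A'^μ_ν := Σ_{α,β} J^μ_α A^α_β (J^{-1})^β_ν. Then sdet A' = sdet A, i.e. the symmetrized determinant of a matrix-valued (1,1)-tensor is invariant under index transformations by scalar matrices (diffeomorphism invariance). -/
/-- The symmetrized product `⟨⟨A_1 ⋯ A_k⟩⟩ = (1/k!) ∑_{φ ∈ S_k} A_{φ(1)} ⋯ A_{φ(k)}`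
of a family of `N × N` complex matrices. -/
noncomputable def symProd {N k : ℕ} (f : Fin k → Matrix (Fin N) (Fin N) ℂ) :
    Matrix (Fin N) (Fin N) ℂ :=
  ((Nat.factorial k : ℂ))⁻¹ • ∑ σ : Equiv.Perm (Fin k), (List.ofFn fun i => f (σ i)).prod

/-- The Levi-Civita symbol `ε_{μ_1 … μ_n}`: the sign of `(μ_1,…,μ_n)` as a permutation
of `(1,…,n)`, and `0` if any index repeats. -/
noncomputable def levi {n : ℕ} (μ : Fin n → Fin n) : ℂ :=
  if h : Function.Bijective μ then ((Equiv.Perm.sign (Equiv.ofBijective μ h) : ℤ) : ℂ) else 0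


/-- The symmetrized determinant of a matrix-valued (1,1)-tensor:
`sdet A := (1/n!) ∑ ε_{μ_1…μ_n} ε^{ν_1…ν_n} ⟨⟨A^{μ_1}_{ν_1} ⋯ A^{μ_n}_{ν_n}⟩⟩`. -/
noncomputable def sdet {N n : ℕ} (A : Fin n → Fin n → Matrix (Fin N) (Fin N) ℂ) :
    Matrix (Fin N) (Fin N) ℂ :=
  ((Nat.factorial n : ℂ))⁻¹ • ∑ μ : Fin n → Fin n, ∑ ν : Fin n → Fin n,
    (levi μ * levi ν) • symProd (fun i => A (μ i) (ν i))

theorem levi_coe_perm {n : ℕ} (σ : Equiv.Perm (Fin n)) :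
    levi (σ : Fin n → Fin n) = ((Equiv.Perm.sign σ : ℤ) : ℂ) := by
  have h : Equiv.ofBijective (σ : Fin n → Fin n) σ.bijective = σ := Equiv.ext fun _ => rfl
  rw [levi, dif_pos σ.bijective, h]

theorem levi_of_not_bijective {n : ℕ} {μ : Fin n → Fin n} (h : ¬ Function.Bijective μ) :
    levi μ = 0 := dif_neg h

/-- Contracting the Levi-Civita symbol with `n` copies of a matrix gives its determinant times the
Levi-Civita symbol of the remaining indices. -/
theorem sum_levi_mul_prod {n : ℕ} (M : Matrix (Fin n) (Fin n) ℂ) (α : Fin n → Fin n) :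
    ∑ μ : Fin n → Fin n, levi μ * ∏ i, M (μ i) (α i) = M.det * levi α := by
  have hdet : ∑ μ : Fin n → Fin n, levi μ * ∏ i, M (μ i) (α i) = (M.submatrix id α).det := by
    rw [Matrix.det_apply']
    symm
    refine Fintype.sum_of_injective (fun σ : Equiv.Perm (Fin n) => (σ : Fin n → Fin n))
      DFunLike.coe_injective _ _ (fun μ hμ => ?_) (fun σ => ?_)
    · rw [levi_of_not_bijective, zero_mul]
      exact fun h => hμ ⟨Equiv.ofBijective μ h, rfl⟩
    · simp [levi_coe_perm]
  rw [hdet]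
  by_cases h : Function.Bijective α
  · obtain ⟨σ, rfl⟩ : ∃ σ : Equiv.Perm (Fin n), (σ : Fin n → Fin n) = α :=
      ⟨Equiv.ofBijective α h, rfl⟩
    rw [levi_coe_perm, Matrix.det_permute', mul_comm]
  · rw [levi_of_not_bijective h, mul_zero]
    have hinj : ¬ Function.Injective α := fun hi => h (Finite.injective_iff_bijective.mp hi)
    obtain ⟨i, j, hij, hne⟩ := Function.not_injective_iff.mp hinj
    exact Matrix.det_zero_of_column_eq hne fun k => by simp [hij]

/-- Multilinear expansion of the symmetrized product. -/
theorem symProd_sum_smul {N k : ℕ} {ι : Type*} [Fintype ι] (c : Fin k → ι → ℂ)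
    (B : ι → Matrix (Fin N) (Fin N) ℂ) :
    symProd (fun i => ∑ p, c i p • B p) =
      ∑ f : Fin k → ι, (∏ i, c i (f i)) • symProd (fun i => B (f i)) := by
  classical
  let S : MultilinearMap ℂ (fun _ : Fin k => Matrix (Fin N) (Fin N) ℂ)
      (Matrix (Fin N) (Fin N) ℂ) :=
    ((Nat.factorial k : ℂ))⁻¹ • ∑ σ : Equiv.Perm (Fin k),
      (MultilinearMap.mkPiAlgebraFin ℂ k (Matrix (Fin N) (Fin N) ℂ)).domDomCongr σ
  have hS : ∀ f, symProd f = S f := fun f => by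
    simp [S, symProd]
  simp_rw [hS]
  rw [MultilinearMap.map_sum]
  exact Finset.sum_congr rfl fun f _ => S.map_smul_univ _ _

/-- The symmetrized determinant scales by `det P * det Q` when the two indices are transformed
by `P` and `Q`. -/
theorem sdet_transform {N n : ℕ} (A : Fin n → Fin n → Matrix (Fin N) (Fin N) ℂ)
    (P Q : Matrix (Fin n) (Fin n) ℂ) :
    sdet (fun μ ν => ∑ α : Fin n, ∑ β : Fin n, (P μ α * Q β ν) • A α β) =
      (P.det * Q.det) • sdet A := by
  have hexp : ∀ μ ν : Fin n → Fin n,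
      symProd (fun i => ∑ α : Fin n, ∑ β : Fin n, (P (μ i) α * Q β (ν i)) • A α β) =
        ∑ α : Fin n → Fin n, ∑ β : Fin n → Fin n,
          ((∏ i, P (μ i) (α i)) * ∏ i, Q (β i) (ν i)) • symProd (fun i => A (α i) (β i)) := by
    intro μ ν
    simp_rw [← Fintype.sum_prod_type']
    rw [symProd_sum_smul (fun i (p : Fin n × Fin n) => P (μ i) p.1 * Q p.2 (ν i))
      (fun p => A p.1 p.2)]
    refine Fintype.sum_equiv (Equiv.arrowProdEquivProdArrow (Fin n) (fun _ => Fin n)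
      (fun _ => Fin n)) _ _ fun f => ?_
    simp [Finset.prod_mul_distrib, Equiv.arrowProdEquivProdArrow]
  have hQ : ∀ β : Fin n → Fin n,
      ∑ ν : Fin n → Fin n, levi ν * ∏ i, Q (β i) (ν i) = Q.det * levi β := fun β => by
    simpa using sum_levi_mul_prod Q.transpose β
  rw [sdet, sdet, smul_comm]
  congr 1
  simp_rw [hexp, Finset.smul_sum, smul_smul]
  calc _ = ∑ α : Fin n → Fin n, ∑ β : Fin n → Fin n, ∑ μ : Fin n → Fin n, ∑ ν : Fin n → Fin n,
        (levi μ * levi ν * ((∏ i, P (μ i) (α i)) * ∏ i, Q (β i) (ν i))) •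
          symProd (fun i => A (α i) (β i)) := by
        have swap : ∀ F : (Fin n → Fin n) → (Fin n → Fin n) → (Fin n → Fin n) →
            (Fin n → Fin n) → Matrix (Fin N) (Fin N) ℂ,
            ∑ μ, ∑ ν, ∑ α, ∑ β, F μ ν α β = ∑ α, ∑ β, ∑ μ, ∑ ν, F μ ν α β := fun F => by
          simp_rw [← Fintype.sum_prod_type' (fun α β => F _ _ α β)]
          rw [← Fintype.sum_prod_type' (fun μ ν => ∑ p : _ × _, F μ ν p.1 p.2),
            Finset.sum_comm, Fintype.sum_prod_type]
          simp_rw [Fintype.sum_prod_type]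
        exact swap _
    _ = _ := by
        refine Finset.sum_congr rfl fun α _ => Finset.sum_congr rfl fun β _ => ?_
        simp_rw [← Finset.sum_smul]
        congr 1
        rw [mul_mul_mul_comm, ← sum_levi_mul_prod P α, ← hQ β, Finset.sum_mul_sum]
        refine Finset.sum_congr rfl fun μ _ => Finset.sum_congr rfl fun ν _ => ?_
        ring

/-- Diffeomorphism invariance of the symmetrized determinant of a (1,1)-tensor:
if `A'^μ_ν = ∑_{α,β} J^μ_α A^α_β (J⁻¹)^β_ν` with `J` an invertible real `n × n`
matrix, then `sdet A' = sdet A`. -/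
theorem sdet_invariant_one_one {N n : ℕ}
    (A : Fin n → Fin n → Matrix (Fin N) (Fin N) ℂ)
    (J : Matrix (Fin n) (Fin n) ℝ) (hJ : IsUnit J) :
    sdet (fun μ ν => ∑ α : Fin n, ∑ β : Fin n, (J μ α * J⁻¹ β ν) • A α β) = sdet A := by
  have h := sdet_transform A (Complex.ofRealHom.mapMatrix J) (Complex.ofRealHom.mapMatrix J⁻¹)
  rw [← Matrix.det_mul, ← map_mul, Matrix.mul_nonsing_inv J ((Matrix.isUnit_iff_isUnit_det J).mp hJ),
    map_one, Matrix.det_one, one_smul] at h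
  rw [← h]
  congr 1
  funext μ ν
  refine Finset.sum_congr rfl fun α _ => Finset.sum_congr rfl fun β _ => ?_
  simp [← Complex.ofReal_mul, Complex.coe_smul]
end

section
/- Let A^μ_ν (μ,ν ∈ {1,…,n}) be a family of N×N complex matrices and let I denote the identity matrix. Then sdet(δ^μ_ν I + A^μ_ν) = I + Σ_{k=1}^{n} ⟨⟨A^{μ_1}_{[μ_1}⋯A^{μ_k}_{μ_k]}⟩⟩, where the k-th term is the totally antisymmetrized contraction (1/k!) Σ_{σ ∈ S_k} sign(σ) Σ_{μ_1,…,μ_k} ⟨⟨A^{μ_1}_{μ_{σ(1)}}⋯A^{μ_k}_{μ_{σ(k)}}⟩⟩. In particular the expansion begins I + A + ½A² − ½⟨⟨A^μ_ν A^ν_μ⟩⟩ + ⋯ + sdet A, where A (without indices) denotes the trace A^μ_μ. -/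
/-- The totally antisymmetrized contraction
`⟨⟨A^{μ_1}{}_{[μ_1} ⋯ A^{μ_k}{}_{μ_k]}⟩⟩
  = (1/k!) ∑_{σ ∈ S_k} sign(σ) ∑_{μ_1,…,μ_k} ⟨⟨A^{μ_1}_{μ_{σ(1)}} ⋯ A^{μ_k}_{μ_{σ(k)}}⟩⟩`. -/
noncomputable def antisymContr {N n : ℕ}
    (A : Fin n → Fin n → Matrix (Fin N) (Fin N) ℂ) (k : ℕ) :
    Matrix (Fin N) (Fin N) ℂ :=
  ((Nat.factorial k : ℂ))⁻¹ • ∑ σ : Equiv.Perm (Fin k),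
    ((Equiv.Perm.sign σ : ℤ) : ℂ) •
      ∑ μ : Fin k → Fin n, symProd (fun i => A (μ i) (μ (σ i)))

theorem map_prod_permutations'Aux_one {E : Type*} [Monoid E] (l : List E) :
    (l.permutations'Aux 1).map List.prod = List.replicate (l.length + 1) l.prod := by
  induction l with
  | nil => simp
  | cons a l ih =>
    have h : (l.permutations'Aux 1).map (List.prod ∘ List.cons a) =
        ((l.permutations'Aux 1).map List.prod).map (a * ·) := by
      simp [Function.comp_def]
    rw [List.permutations'Aux, List.map_cons, List.map_map, h, ih]
    simp [List.replicate_succ]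

section SymmetrizedProduct

variable {E : Type*} [Ring E] [Algebra ℂ E]

/-- The symmetrized product of a multiset of elements of a `ℂ`-algebra. -/
noncomputable def multisetSymProd (s : Multiset E) : E :=
  ((Nat.factorial s.card : ℂ))⁻¹ •
    Quot.liftOn s (fun l : List E => (l.permutations'.map List.prod).sum)
      fun _ _ h => (h.permutations'.map _).sum_eq

theorem multisetSymProd_coe (l : List E) :
    multisetSymProd (l : Multiset E) =
      ((Nat.factorial l.length : ℂ))⁻¹ • (l.permutations'.map List.prod).sum :=
  rfl

@[simp]
theorem multisetSymProd_zero : multisetSymProd (0 : Multiset E) = 1 := by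
  simp [← Multiset.coe_nil, multisetSymProd_coe]

@[simp]
theorem multisetSymProd_one_cons (s : Multiset E) :
    multisetSymProd (1 ::ₘ s) = multisetSymProd s := by
  induction s using Quotient.inductionOn with | _ l
  have h : ((1 :: l).permutations'.map List.prod).sum =
      ((l.length + 1 : ℕ) : ℂ) • (l.permutations'.map List.prod).sum := by
    rw [List.permutations', List.map_flatMap, List.flatMap_def, List.sum_flatten, List.smul_sum,
      List.map_map, List.map_map]
    congr 1
    refine List.map_congr_left fun l' hl' => ?_
    rw [Function.comp_apply, map_prod_permutations'Aux_one, (List.mem_permutations'.1 hl').length_eq]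
    simp [Algebra.smul_def]
  simp only [Multiset.quot_mk_to_coe, Multiset.cons_coe, multisetSymProd_coe, h,
    List.length_cons, Nat.factorial_succ, smul_smul]
  congr 1
  have := Nat.cast_add_one_ne_zero (R := ℂ) l.length
  push_cast
  field_simp

theorem multisetSymProd_replicate_one_add (k : ℕ) (s : Multiset E) :
    multisetSymProd (Multiset.replicate k 1 + s) = multisetSymProd s := by
  induction k with
  | zero => simp
  | succ k ih => rw [Multiset.replicate_succ, Multiset.cons_add, multisetSymProd_one_cons, ih]

/-- The linear map sending each monomial in the variables `X i` to the symmetrized product of the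
corresponding `A i`. -/
noncomputable def symmetrization {ι : Type*} (A : ι → E) : MvPolynomial ι ℂ →ₗ[ℂ] E :=
  (MvPolynomial.basisMonomials ι ℂ).constr ℂ fun m => multisetSymProd (m.toMultiset.map A)

theorem symmetrization_prod_X {ι κ : Type*} (A : ι → E) (s : Finset κ) (p : κ → ι) :
    symmetrization A (∏ i ∈ s, MvPolynomial.X (p i)) =
      multisetSymProd (s.val.map fun i => A (p i)) := by
  have h : (∏ i ∈ s, MvPolynomial.X (p i) : MvPolynomial ι ℂ) =
      MvPolynomial.basisMonomials ι ℂ (∑ i ∈ s, Finsupp.single (p i) 1) := by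
    rw [MvPolynomial.coe_basisMonomials]
    beta_reduce
    rw [MvPolynomial.monomial_sum_one]
    rfl
  rw [symmetrization, h, Module.Basis.constr_basis, map_sum]
  simp only [Finsupp.toMultiset_single, one_smul]
  have hp : ∑ i ∈ s, ({p i} : Multiset ι) = s.val.map p := by
    rw [← Multiset.sum_map_singleton (s.val.map p), Multiset.map_map]
    rfl
  rw [hp, Multiset.map_map]
  rfl

end SymmetrizedProduct

/-- The words `σ(1) … σ(k)`, for `σ` a permutation, are the permutations of the list `1, …, k`. -/
theorem map_ofFn_perm_eq_permutations' (k : ℕ) :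
    (Finset.univ.val.map fun σ : Equiv.Perm (Fin k) => List.ofFn σ) =
      ((List.finRange k).permutations' : Multiset (List (Fin k))) := by
  refine (Multiset.Nodup.ext ?_ ?_).2 fun l => ?_
  · exact Finset.univ.nodup.map fun σ τ h => Equiv.ext fun i => congrFun (List.ofFn_injective h) i
  · rw [Multiset.coe_nodup, ← (List.permutations_perm_permutations' _).nodup_iff]
    exact List.nodup_permutations _ (List.nodup_finRange k)
  · simp only [Multiset.mem_map, Finset.mem_val, Finset.mem_univ, true_and, Multiset.mem_coe,
      List.mem_permutations']
    constructor
    · rintro ⟨σ, rfl⟩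
      rw [List.ofFn_eq_map]
      exact Equiv.Perm.map_finRange_perm σ
    · intro h
      obtain ⟨f, rfl⟩ : ∃ f : Fin k → Fin k, List.ofFn f = l := by
        have hl : l.length = k := by simpa using h.length_eq
        exact ⟨fun i => l.get (i.cast hl.symm), by simp [List.ext_get_iff, hl]⟩
      have hf : Function.Injective f :=
        List.nodup_ofFn.1 (h.nodup_iff.2 (List.nodup_finRange _))
      exact ⟨Equiv.ofBijective f (Finite.injective_iff_bijective.1 hf), rfl⟩

theorem symProd_eq_multisetSymProd {N k : ℕ} (f : Fin k → Matrix (Fin N) (Fin N) ℂ) :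
    symProd f = multisetSymProd (Finset.univ.val.map f) := by
  have h : ∑ σ : Equiv.Perm (Fin k), (List.ofFn fun i => f (σ i)).prod =
      (((List.finRange k).map f).permutations'.map List.prod).sum := by
    rw [← List.map_permutations', List.map_map, ← Multiset.sum_coe, ← Multiset.map_coe,
      ← map_ofFn_perm_eq_permutations', Multiset.map_map]
    simp only [Finset.sum, Function.comp_def, List.map_ofFn]
  have h' : (Finset.univ.val.map f) = (((List.finRange k).map f : List _) : Multiset _) := by
    rw [Fin.univ_val_map, List.ofFn_eq_map]
  rw [symProd, h, h', multisetSymProd_coe]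
  simp

/-- The symmetrized product as a multilinear map. -/
noncomputable def symProdMultilinear (N k : ℕ) :
    MultilinearMap ℂ (fun _ : Fin k => Matrix (Fin N) (Fin N) ℂ) (Matrix (Fin N) (Fin N) ℂ) :=
  ((Nat.factorial k : ℂ))⁻¹ • ∑ σ : Equiv.Perm (Fin k),
    (MultilinearMap.mkPiAlgebraFin ℂ k (Matrix (Fin N) (Fin N) ℂ)).domDomCongr σ

theorem symProdMultilinear_apply {N k : ℕ} (f : Fin k → Matrix (Fin N) (Fin N) ℂ) :
    symProdMultilinear N k f = symProd f := by
  simp only [symProdMultilinear, symProd, smul_apply, sum_apply,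
    MultilinearMap.domDomCongr_apply, MultilinearMap.mkPiAlgebraFin_apply]

theorem symProd_smul_one_add {N k : ℕ} {ι : Type*} (A : ι → Matrix (Fin N) (Fin N) ℂ)
    (c : Fin k → ℂ) (p : Fin k → ι) :
    symProd (fun i => c i • 1 + A (p i)) =
      symmetrization A (∏ i, (MvPolynomial.C (c i) + MvPolynomial.X (p i))) := by
  rw [Finset.prod_add, map_sum, Finset.powerset_univ, ← symProdMultilinear_apply]
  refine (MultilinearMap.map_add_univ _ (fun i => c i • 1) fun i => A (p i)).trans
    (Finset.sum_congr rfl fun s _ => ?_)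
  have hs : s.piecewise (fun i => c i • (1 : Matrix (Fin N) (Fin N) ℂ)) (fun i => A (p i)) =
      s.piecewise (fun i => c i • s.piecewise (fun _ => 1) (fun i => A (p i)) i)
        (s.piecewise (fun _ => 1) (fun i => A (p i))) := by
    ext1 i
    by_cases hi : i ∈ s <;> simp [hi]
  rw [hs, MultilinearMap.map_piecewise_smul, symProdMultilinear_apply, symProd_eq_multisetSymProd,
    ← map_prod, ← MvPolynomial.smul_eq_C_mul, map_smul, symmetrization_prod_X]
  congr 1
  have hu : (Finset.univ : Finset (Fin k)).val = s.val + (Finset.univ \ s).val := by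
    rw [← Finset.disjUnion_val _ _ Finset.disjoint_sdiff, Finset.disjUnion_eq_union,
      Finset.union_sdiff_of_subset s.subset_univ]
  rw [hu, Multiset.map_add,
    Multiset.map_congr rfl (g := fun _ => (1 : Matrix (Fin N) (Fin N) ℂ)) (s := s.val)
      fun i hi => by
        rw [Finset.piecewise_eq_of_mem _ _ _ hi],
    Multiset.map_congr rfl (g := fun i => A (p i)) (s := (Finset.univ \ s).val)
      fun i hi => by
        rw [Finset.piecewise_eq_of_notMem _ _ _ (Finset.mem_sdiff.1 hi).2],
    Multiset.map_const', multisetSymProd_replicate_one_add]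

theorem sum_levi_smul {n : ℕ} {V : Type*} [AddCommGroup V] [Module ℂ V]
    (F : (Fin n → Fin n) → V) :
    ∑ μ, levi μ • F μ = ∑ σ : Equiv.Perm (Fin n), ((Equiv.Perm.sign σ : ℤ) : ℂ) • F σ := by
  refine (Fintype.sum_of_injective (fun σ : Equiv.Perm (Fin n) => (σ : Fin n → Fin n))
    DFunLike.coe_injective _ _ (fun μ hμ => ?_) fun σ => ?_).symm
  · have : ¬ Function.Bijective μ := fun h => hμ ⟨Equiv.ofBijective μ h, rfl⟩
    rw [levi, dif_neg this, zero_smul]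
  · have : Equiv.ofBijective σ σ.bijective = σ := Equiv.ext fun _ => rfl
    rw [levi, dif_pos σ.bijective, this]

theorem sum_sign_smul_prod_eq_det {k : ℕ} {R : Type*} [CommRing R] [Algebra ℂ R]
    (M : Matrix (Fin k) (Fin k) R) :
    ∑ σ : Equiv.Perm (Fin k), ((Equiv.Perm.sign σ : ℤ) : ℂ) • ∏ i, M i (σ i) = M.det := by
  rw [← Matrix.det_transpose, Matrix.det_apply']
  simp [Algebra.smul_def]

/-- A determinant as a sum over two index functions weighted by Levi-Civita symbols. -/
theorem sum_levi_mul_levi {n : ℕ} {R : Type*} [CommRing R] [Algebra ℂ R]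
    (B : Matrix (Fin n) (Fin n) R) :
    ∑ μ : Fin n → Fin n, ∑ ν : Fin n → Fin n, (levi μ * levi ν) • ∏ i, B (μ i) (ν i) =
      (Nat.factorial n : ℂ) • B.det := by
  simp_rw [mul_smul, ← Finset.smul_sum, sum_levi_smul]
  have h (σ : Equiv.Perm (Fin n)) :
      ((Equiv.Perm.sign σ : ℤ) : ℂ) • ∑ τ : Equiv.Perm (Fin n),
        ((Equiv.Perm.sign τ : ℤ) : ℂ) • ∏ i, B (σ i) (τ i) = B.det := by
    have := sum_sign_smul_prod_eq_det (B.submatrix σ id)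
    simp only [Matrix.submatrix_apply, id] at this
    rw [this, Matrix.det_permute, Algebra.smul_def, ← mul_assoc]
    rcases Int.units_eq_one_or (Equiv.Perm.sign σ) with h | h <;> simp [h]
  simp_rw [h]
  simp [Fintype.card_perm, Nat.cast_smul_eq_nsmul]

theorem card_filter_image_univ_eq {n k : ℕ} {s : Finset (Fin n)} (hs : s.card = k) :
    (Finset.univ.filter fun μ : Fin k → Fin n => Finset.univ.image μ = s).card =
      Nat.factorial k := by
  have e : Fin k ≃ s := Fintype.equivOfCardEq (by simp [hs])
  have hc : Fintype.card (Fin k ≃ s) = Nat.factorial k := by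
    rw [Fintype.card_equiv e, Fintype.card_fin]
  rw [← hc, ← Finset.card_univ]
  symm
  refine Finset.card_bij (fun e _ i => (e i : Fin n)) (fun e _ => ?_) (fun e _ e' _ h => ?_)
    fun μ hμ => ?_
  · rw [Finset.mem_filter_univ]
    ext x
    simp only [Finset.mem_image, Finset.mem_univ, true_and]
    exact ⟨fun ⟨i, hi⟩ => hi ▸ (e i).2, fun hx => ⟨e.symm ⟨x, hx⟩, by simp⟩⟩
  · exact Equiv.ext fun i => Subtype.ext (congrFun h i)
  · rw [Finset.mem_filter_univ] at hμ
    subst hμ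
    have hinj : Function.Injective μ := by
      rw [← Set.injOn_univ, ← Finset.coe_univ, ← Finset.card_image_iff, hs, Finset.card_fin]
    let f : Fin k → Finset.univ.image μ :=
      fun i => ⟨μ i, Finset.mem_image_of_mem _ (Finset.mem_univ i)⟩
    have hf : Function.Bijective f :=
      (Fintype.bijective_iff_injective_and_card f).2
        ⟨fun i j h => hinj (congrArg Subtype.val h), Fintype.card_congr e⟩
    exact ⟨Equiv.ofBijective f hf, Finset.mem_univ _, rfl⟩

/-- The sum of all principal minors of a fixed size, over all index functions. -/
theorem sum_det_submatrix_fun {n k : ℕ} {R : Type*} [CommRing R] (B : Matrix (Fin n) (Fin n) R) :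
    ∑ μ : Fin k → Fin n, (B.submatrix μ μ).det =
      Nat.factorial k • ∑ s ∈ Finset.univ.powersetCard k,
        (B.submatrix (Subtype.val : s → Fin n) (Subtype.val : s → Fin n)).det := by
  rw [← Finset.sum_fiberwise Finset.univ (fun μ : Fin k → Fin n => Finset.univ.image μ),
    Finset.smul_sum]
  symm
  refine Finset.sum_subset_zero_on_sdiff (Finset.subset_univ _) (fun s hs => ?_) fun s hs => ?_
  · refine Finset.sum_eq_zero fun μ hμ => ?_
    rw [Finset.mem_filter_univ] at hμ
    have hinj : ¬ Function.Injective μ := fun h => by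
      simp [← hμ, Finset.mem_powersetCard, Finset.card_image_of_injective _ h] at hs
    obtain ⟨i, j, hij, hne⟩ := Function.not_injective_iff.1 hinj
    exact Matrix.det_zero_of_row_eq hne (by ext l; simp [hij])
  · have hcard : s.card = k := (Finset.mem_powersetCard.1 hs).2
    rw [← card_filter_image_univ_eq hcard]
    symm
    refine Finset.sum_eq_card_nsmul fun μ hμ => ?_
    rw [Finset.mem_filter_univ] at hμ
    subst hμ
    let f : Fin k → Finset.univ.image μ :=
      fun i => ⟨μ i, Finset.mem_image_of_mem _ (Finset.mem_univ i)⟩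
    have hf : Function.Bijective f := by
      refine (Fintype.bijective_iff_surjective_and_card f).2 ⟨fun ⟨x, hx⟩ => ?_, by
        rw [Fintype.card_coe, hcard, Fintype.card_fin]⟩
      obtain ⟨i, -, rfl⟩ := Finset.mem_image.1 hx
      exact ⟨i, rfl⟩
    rw [← Matrix.det_submatrix_equiv_self (Equiv.ofBijective f hf), Matrix.submatrix_submatrix]
    rfl

theorem det_one_add_eq_sum_minors {n : ℕ} {R : Type*} [CommRing R] (B : Matrix (Fin n) (Fin n) R) :
    (1 + B).det = ∑ s : Finset (Fin n),
      (B.submatrix (Subtype.val : s → Fin n) (Subtype.val : s → Fin n)).det := by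
  rw [add_comm]
  refine (Matrix.detRowAlternating.map_add_univ B (1 : Matrix (Fin n) (Fin n) R)).trans ?_
  exact Finset.sum_congr rfl fun s _ => Matrix.det_piecewise_one_eq_submatrix_det B s

theorem sdet_one_add_eq_symmetrization_det {N n : ℕ}
    (A : Fin n → Fin n → Matrix (Fin N) (Fin N) ℂ) :
    sdet (fun μ ν => (if μ = ν then (1 : Matrix (Fin N) (Fin N) ℂ) else 0) + A μ ν) =
      symmetrization (fun p : Fin n × Fin n => A p.1 p.2)
        (1 + Matrix.mvPolynomialX (Fin n) (Fin n) ℂ).det := by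
  have h (μ ν : Fin n → Fin n) :
      symProd (fun i => (if μ i = ν i then (1 : Matrix (Fin N) (Fin N) ℂ) else 0) +
        A (μ i) (ν i)) = symmetrization (fun p : Fin n × Fin n => A p.1 p.2)
          (∏ i, (1 + Matrix.mvPolynomialX (Fin n) (Fin n) ℂ) (μ i) (ν i)) := by
    have := symProd_smul_one_add (fun p : Fin n × Fin n => A p.1 p.2)
      (fun i => if μ i = ν i then 1 else 0) fun i => (μ i, ν i)
    simpa [Matrix.one_apply, apply_ite] using this
  simp_rw [sdet, h, ← map_smul, ← map_sum]
  rw [sum_levi_mul_levi, map_smul, smul_smul, inv_mul_cancel₀ (by exact_mod_cast n.factorial_ne_zero),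
    one_smul]

theorem antisymContr_eq_symmetrization {N n : ℕ}
    (A : Fin n → Fin n → Matrix (Fin N) (Fin N) ℂ) (k : ℕ) :
    antisymContr A k = symmetrization (fun p : Fin n × Fin n => A p.1 p.2)
      (∑ s ∈ Finset.univ.powersetCard k, ((Matrix.mvPolynomialX (Fin n) (Fin n) ℂ).submatrix
        (Subtype.val : s → Fin n) (Subtype.val : s → Fin n)).det) := by
  have h (σ : Equiv.Perm (Fin k)) (μ : Fin k → Fin n) :
      symProd (fun i => A (μ i) (μ (σ i))) = symmetrization (fun p : Fin n × Fin n => A p.1 p.2)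
        (∏ i, (Matrix.mvPolynomialX (Fin n) (Fin n) ℂ).submatrix μ μ i (σ i)) := by
    rw [symProd_eq_multisetSymProd]
    simp only [Matrix.submatrix_apply, Matrix.mvPolynomialX_apply]
    rw [symmetrization_prod_X]
  simp_rw [antisymContr, h, Finset.smul_sum (s := (Finset.univ : Finset (Fin k → Fin n)))]
  rw [Finset.sum_comm]
  simp_rw [← map_smul, ← map_sum, sum_sign_smul_prod_eq_det]
  rw [sum_det_submatrix_fun, ← Nat.cast_smul_eq_nsmul ℂ, map_smul, smul_smul,
    inv_mul_cancel₀ (by exact_mod_cast k.factorial_ne_zero), one_smul]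

/-- Expansion of the symmetrized determinant:
`sdet(δ^μ_ν I + A^μ_ν) = I + ∑_{k=1}^{n} ⟨⟨A^{μ_1}{}_{[μ_1} ⋯ A^{μ_k}{}_{μ_k]}⟩⟩`
(whose expansion begins `I + A + ½A² − ½⟨⟨A^μ_ν A^ν_μ⟩⟩ + ⋯ + sdet A`). -/
theorem sdet_one_add {N n : ℕ}
    (A : Fin n → Fin n → Matrix (Fin N) (Fin N) ℂ) :
    sdet (fun μ ν => (if μ = ν then (1 : Matrix (Fin N) (Fin N) ℂ) else 0) + A μ ν)
      = 1 + ∑ k ∈ Finset.Icc 1 n, antisymContr A k := by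
  have h0 : antisymContr A 0 = 1 := by
    simp [antisymContr, symProd]
  rw [sdet_one_add_eq_symmetrization_det, det_one_add_eq_sum_minors, ← Finset.powerset_univ,
    Finset.sum_powerset, map_sum, Finset.card_univ, Fintype.card_fin, Finset.range_eq_Ico,
    Finset.sum_eq_sum_Ico_succ_bot (Nat.succ_pos n), ← antisymContr_eq_symmetrization, h0]
  simp_rw [← antisymContr_eq_symmetrization]
  rfl
end
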